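/- Let (E, L) be a Euclidean lattice and F a nonzero rational subspace of E. Then min( H_min(F, F ∩ L), H_min of the quotient lattice of (E, L) by F ) ≤ H_min(E, L) ≤ H_min(F, F ∩ L). In particular, if H_min(F, F ∩ L) ≤ H_min of the quotient lattice of (E, L) by F, then H_min(E, L) = H_min(F, F ∩ L). -/

import Mathlib

open Module

noncomputable section

namespace EucLat

variable {E : Type*} [NormedAddCommGroup E] [InnerProductSpace ℝ E]

/-- The covolume of a `ℤ`-submodule of a real inner product space: the square root of the
Gram determinant of a `ℤ`-basis (junk value `0` if no finite basis exists). -/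
def covol (L : Submodule ℤ E) : ℝ :=
  @dite _ (∃ n : ℕ, Nonempty (Basis (Fin n) ℤ L)) (Classical.propDecidable _)
    (fun h => Real.sqrt (Matrix.det (Matrix.of fun i j =>
      (inner ℝ ((h.choose_spec.some i : L) : E) ((h.choose_spec.some j : L) : E) : ℝ))))
    (fun _ => 0)

/-- The reduced height `covol(L)^(1/dim E)` of a full lattice. -/
def redH (L : Submodule ℤ E) : ℝ := covol L ^ ((finrank ℝ E : ℝ)⁻¹)

/-- The lattice `L ∩ F` induced on a subspace `F`. -/
def latIn (L : Submodule ℤ E) (F : Submodule ℝ E) : Submodule ℤ F :=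
  L.comap (F.subtype.restrictScalars ℤ)

/-- The reduced height of a subspace: `covol(F ∩ L)^(1/dim F)`. -/
def Hr (L : Submodule ℤ E) (F : Submodule ℝ E) : ℝ := redH (latIn L F)

/-- A subspace is rational if it is spanned by its intersection with the lattice. -/
def IsRational (L : Submodule ℤ E) (F : Submodule ℝ E) : Prop :=
  Submodule.span ℝ ((L : Set E) ∩ (F : Set E)) = F

/-- `(E, L)` is a Euclidean lattice: `L` is discrete and spans `E` over `ℝ`. -/
def IsLat (L : Submodule ℤ E) : Prop :=
  DiscreteTopology L ∧ Submodule.span ℝ (L : Set E) = ⊤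

/-- Minimal reduced height: infimum of reduced heights of nonzero rational subspaces. -/
def Hmin (L : Submodule ℤ E) : ℝ :=
  sInf {h : ℝ | ∃ F : Submodule ℝ E, F ≠ ⊥ ∧ IsRational L F ∧ h = Hr L F}

/-- Semistability of a Euclidean lattice. -/
def Semistable (L : Submodule ℤ E) : Prop :=
  ∀ F : Submodule ℝ E, F ≠ ⊥ → IsRational L F → redH L ≤ Hr L F

/-- Stability of a Euclidean lattice. -/
def Stable (L : Submodule ℤ E) : Prop :=
  Semistable L ∧ ∀ F : Submodule ℝ E, F ≠ ⊥ → F ≠ ⊤ → IsRational L F → redH L < Hr L F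

/-- The quotient lattice of `(E, L)` by a subspace `F`: the image of `L` under the
orthogonal projection of `E` onto `Fᗮ`. -/
def quotLat [FiniteDimensional ℝ E] (L : Submodule ℤ E) (F : Submodule ℝ E) :
    Submodule ℤ Fᗮ :=
  L.map ((Submodule.orthogonalProjectionOnto Fᗮ : E →ₗ[ℝ] Fᗮ).restrictScalars ℤ)

/-- For subspaces `F ≤ F'`, the successive quotient lattice: the image of `F' ∩ L` under the
orthogonal projection of `F'` onto the orthogonal complement of `F` inside `F'`. -/
def succQuot [FiniteDimensional ℝ E] (L : Submodule ℤ E) (F F' : Submodule ℝ E) :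
    Submodule ℤ ((F.comap F'.subtype)ᗮ) :=
  quotLat (latIn L F') (F.comap F'.subtype)

/-- A GS-flag of `(E, L)`. -/
def IsGSFlag [FiniteDimensional ℝ E] (L : Submodule ℤ E) {ℓ : ℕ}
    (C : Fin (ℓ + 1) → Submodule ℝ E) : Prop :=
  C 0 = ⊥ ∧ C (Fin.last ℓ) = ⊤ ∧
  (∀ i : Fin ℓ, C i.castSucc < C i.succ) ∧
  (∀ i, IsRational L (C i)) ∧
  (∀ i : Fin ℓ, Semistable (succQuot L (C i.castSucc) (C i.succ))) ∧
  (∀ i j : Fin ℓ, i < j →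
    redH (succQuot L (C i.castSucc) (C i.succ)) < redH (succQuot L (C j.castSucc) (C j.succ)))

/-- The dual lattice `L* = {y : ⟪x, y⟫ ∈ ℤ for all x ∈ L}`. -/
def dualLat (L : Submodule ℤ E) : Submodule ℤ E where
  carrier := {y | ∀ x ∈ L, ∃ n : ℤ, (inner ℝ x y : ℝ) = n}
  zero_mem' := fun x _ => ⟨0, by simp⟩
  add_mem' := by
    intro a b ha hb x hx
    obtain ⟨m, hm⟩ := ha x hx
    obtain ⟨n, hn⟩ := hb x hx
    exact ⟨m + n, by rw [inner_add_right, hm, hn]; push_cast; ring⟩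
  smul_mem' := by
    intro z y hy x hx
    obtain ⟨n, hn⟩ := hy x hx
    refine ⟨z * n, ?_⟩
    rw [← Int.cast_smul_eq_zsmul ℝ, real_inner_smul_right, hn]
    push_cast; ring

/-- `(E, L)` is isodual via the similarity `τ`. -/
def IsIsodual (L : Submodule ℤ E) (τ : E →ₗ[ℝ] E) : Prop :=
  (∃ α : ℝ, 0 < α ∧ ∀ x y : E, (inner ℝ (τ x) (τ y) : ℝ) = α * inner ℝ x y) ∧
  L.map (τ.restrictScalars ℤ) = dualLat L

/-- The bilinear form `b_τ(x, y) = ⟪τ x, y⟫` associated with an isoduality. -/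
def bform (τ : E →ₗ[ℝ] E) (x y : E) : ℝ := inner ℝ (τ x) y

/-- `b` has signature `s`: there is a `b`-orthogonal basis with `p - q = s`. -/
def HasSignature (b : E → E → ℝ) (s : ℤ) : Prop :=
  ∃ (n : ℕ) (v : Basis (Fin n) ℝ E),
    (∀ i j, i ≠ j → b (v i) (v j) = 0) ∧
    s = ((Finset.univ.filter fun i => 0 < b (v i) (v i)).card : ℤ) -
        ((Finset.univ.filter fun i => b (v i) (v i) < 0).card : ℤ)

/-- The destabilizing subspace of `(E, L)`. -/
def IsDestabilizing (L : Submodule ℤ E) (F : Submodule ℝ E) : Prop :=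
  F ≠ ⊥ ∧ IsRational L F ∧ Hr L F = Hmin L ∧
  ∀ F' : Submodule ℝ E, F' ≠ ⊥ → IsRational L F' → Hr L F' = Hmin L → F' ≤ F

/-- `(G, t)` is a realization of the tensor product of the inner product spaces `E` and `F`:
`t` induces a linear isomorphism `E ⊗ F ≃ G` and
`⟪t x y, t x' y'⟫ = ⟪x, x'⟫ * ⟪y, y'⟫` on pure tensors. -/
def IsTensor {F G : Type*} [NormedAddCommGroup F] [InnerProductSpace ℝ F]
    [NormedAddCommGroup G] [InnerProductSpace ℝ G] (t : E →ₗ[ℝ] F →ₗ[ℝ] G) : Prop :=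
  Function.Bijective (TensorProduct.lift t) ∧
  ∀ (x x' : E) (y y' : F),
    (inner ℝ (t x y) (t x' y') : ℝ) = (inner ℝ x x' : ℝ) * (inner ℝ y y' : ℝ)

/-- The tensor product lattice `L·M`: the additive subgroup generated by pure tensors. -/
def tensorLat {F G : Type*} [NormedAddCommGroup F] [InnerProductSpace ℝ F]
    [NormedAddCommGroup G] [InnerProductSpace ℝ G] (t : E →ₗ[ℝ] F →ₗ[ℝ] G)
    (L : Submodule ℤ E) (M : Submodule ℤ F) : Submodule ℤ G :=
  Submodule.span ℤ (Set.image2 (fun x y => t x y) (L : Set E) (M : Set F))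

/-- `g` is an automorphism of the Euclidean lattice `(E, L)`. -/
def IsAut (L : Submodule ℤ E) (g : E ≃ₗ[ℝ] E) : Prop :=
  (∀ x, x ∈ L ↔ g x ∈ L) ∧ ∀ x y : E, (inner ℝ (g x) (g y) : ℝ) = inner ℝ x y

/-- The direct product lattice `L × L'` inside `WithLp 2 (E × E')`. -/
def prodLat {E' : Type*} [NormedAddCommGroup E'] [InnerProductSpace ℝ E']
    (L : Submodule ℤ E) (L' : Submodule ℤ E') : Submodule ℤ (WithLp 2 (E × E')) :=
  (L.prod L').comap (((WithLp.linearEquiv 2 ℝ (E × E')).restrictScalars ℤ) : WithLp 2 (E × E') →ₗ[ℤ] E × E')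


section Helpers

open Matrix
open scoped MatrixOrder ComplexOrder

lemma det_one_add {n : Type*} [Fintype n] [DecidableEq n] (S : Matrix n n ℝ) (hS : S.PosSemidef) :
    1 ≤ (1 + S).det := by
  have hH : (1 + S).IsHermitian := Matrix.isHermitian_one.add hS.1
  rw [hH.det_eq_prod_eigenvalues]
  rw [← Finset.prod_const_one (s := Finset.univ (α := n))]
  refine Finset.prod_le_prod (fun _ _ => zero_le_one) fun i _ => ?_
  have h := hH.mulVec_eigenvectorBasis i
  set x := (hH.eigenvectorBasis i).ofLp with hx
  have h1 : x ⬝ᵥ x = 1 := by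
    have := hH.eigenvectorBasis.orthonormal.1 i
    have h2 := real_inner_self_eq_norm_sq (hH.eigenvectorBasis i)
    rw [this, EuclideanSpace.inner_eq_star_dotProduct] at h2
    simpa using h2
  have h2 : x ⬝ᵥ ((1 + S) *ᵥ x) = hH.eigenvalues i := by
    rw [h, dotProduct_smul, h1]; simp
  have h3 := hS.dotProduct_mulVec_nonneg x
  rw [add_mulVec, one_mulVec, dotProduct_add, h1] at h2
  simp only [star_trivial] at h3
  simp only [RCLike.ofReal_real_eq_id, id]
  linarith

lemma det_le_add {n : Type*} [Fintype n] [DecidableEq n] (V S : Matrix n n ℝ) (hV : V.PosDef)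
    (hS : S.PosSemidef) : V.det ≤ (V + S).det := by
  obtain ⟨C, rfl⟩ := CStarAlgebra.nonneg_iff_eq_star_mul_self.mp hV.posSemidef.nonneg
  rw [star_eq_conjTranspose] at hV ⊢
  have hd : IsUnit C.det := by
    have := hV.det_pos.ne'
    rw [det_mul] at this
    exact isUnit_iff_ne_zero.2 (right_ne_zero_of_mul this)
  have h1 : Cᴴ * C + S = Cᴴ * (1 + (C⁻¹)ᴴ * S * C⁻¹) * C := by
    have e1 : Cᴴ * (C⁻¹)ᴴ = 1 := by
      rw [← conjTranspose_mul, nonsing_inv_mul _ hd, conjTranspose_one]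
    have e2 : C⁻¹ * C = 1 := nonsing_inv_mul _ hd
    rw [mul_add, add_mul, mul_one]
    congr 1
    calc S = (Cᴴ * (C⁻¹)ᴴ) * S * (C⁻¹ * C) := by rw [e1, e2]; simp
      _ = _ := by simp only [mul_assoc]
  have h2 := det_one_add _ (hS.conjTranspose_mul_mul_same C⁻¹)
  rw [h1, det_mul, det_mul, det_mul]
  have h3 : 0 ≤ Cᴴ.det * C.det := by rw [det_conjTranspose]; simpa using mul_self_nonneg C.det
  nlinarith

lemma gram_block {E : Type*} [NormedAddCommGroup E] [InnerProductSpace ℝ E] {a b : Type*}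
    [Fintype a] [DecidableEq a] [Fintype b] [DecidableEq b] (u : a → E) (v w r : b → E)
    (hv : ∀ j, v j = w j + r j) (hur : ∀ i j, inner ℝ (u i) (r j) = 0)
    (hwr : ∀ i j, inner ℝ (w i) (r j) = 0)
    (hu : LinearIndependent ℝ u) (hr : LinearIndependent ℝ r) :
    (gram ℝ u).det * (gram ℝ r).det ≤ (gram ℝ (Sum.elim u v)).det := by
  have hU := posDef_gram_of_linearIndependent hu
  have hR := posDef_gram_of_linearIndependent hr
  let B : Matrix a b ℝ := of fun i j => inner ℝ (u i) (w j)
  have e1 : gram ℝ (Sum.elim u v) = fromBlocks (gram ℝ u) B Bᴴ (gram ℝ w + gram ℝ r) := by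
    ext i j
    have hrw : ∀ i j, inner ℝ (r j) (w i) = 0 := fun i j => by rw [real_inner_comm]; exact hwr i j
    have hru : ∀ i j, inner ℝ (r j) (u i) = 0 := fun i j => by rw [real_inner_comm]; exact hur i j
    rcases i with i | i <;> rcases j with j | j <;>
      simp [B, hv, inner_add_left, inner_add_right, hur, hwr, hrw, hru, real_inner_comm]
  have e2 : gram ℝ (Sum.elim u w) = fromBlocks (gram ℝ u) B Bᴴ (gram ℝ w) := by
    ext i j
    rcases i with i | i <;> rcases j with j | j <;> simp [B, real_inner_comm]
  have h2 := posSemidef_gram ℝ (Sum.elim u w)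
  let _ : Invertible (gram ℝ u) := hU.isUnit.invertible
  rw [e2, PosDef.fromBlocks₁₁ _ _ hU] at h2
  rw [e1, det_fromBlocks₁₁]
  have e3 : gram ℝ w + gram ℝ r - Bᴴ * ⅟(gram ℝ u) * B
    = gram ℝ r + (gram ℝ w - Bᴴ * (gram ℝ u)⁻¹ * B) := by
      rw [invOf_eq_nonsing_inv]; abel
  rw [e3]
  exact mul_le_mul_of_nonneg_left (det_le_add _ _ hR h2) hU.det_pos.le

lemma gram_le {E : Type*} [NormedAddCommGroup E] [InnerProductSpace ℝ E] {a : Type*}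
    [Fintype a] [DecidableEq a] (v v' : a → E) (h : ∀ i, v' i ∈ Submodule.span ℤ (Set.range v))
    (hv' : LinearIndependent ℤ v') : (gram ℝ v).det ≤ (gram ℝ v').det := by
  have h1 : ∀ i, ∃ c : a → ℤ, ∑ j, c j • v j = v' i := fun i =>
    (Submodule.mem_span_range_iff_exists_fun ℤ).1 (h i)
  choose P hP using h1
  let P' : Matrix a a ℤ := of P
  have hd : P'.det ≠ 0 := by
    intro h0
    obtain ⟨x, hx, hx0⟩ := exists_vecMul_eq_zero_iff.2 h0
    apply hx
    ext i
    refine Fintype.linearIndependent_iff.1 hv' x ?_ i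
    simp_rw [← hP, Finset.smul_sum, smul_smul]
    rw [Finset.sum_comm]
    simp_rw [← Finset.sum_smul]
    apply Finset.sum_eq_zero
    intro j _
    have := congrFun hx0 j
    simp only [vecMul, dotProduct, P', of_apply, Pi.zero_apply] at this
    rw [this, zero_smul]
  let Q : Matrix a a ℝ := P'.map (Int.castRingHom ℝ)
  have e : gram ℝ v' = Q * gram ℝ v * Qᵀ := by
    ext i j
    simp only [gram_apply, ← hP, mul_apply, transpose_apply, sum_inner, inner_sum, Q, P', map_apply,
      of_apply, Finset.sum_mul]
    refine Finset.sum_congr rfl fun k _ => Finset.sum_congr rfl fun l _ => ?_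
    rw [← Int.cast_smul_eq_zsmul ℝ, ← Int.cast_smul_eq_zsmul ℝ, real_inner_smul_left,
      real_inner_smul_right]
    simp; ring
  have hdet : Q.det = (P'.det : ℝ) := by
    simp only [Q]
    rw [← RingHom.mapMatrix_apply, ← RingHom.map_det]; simp
  rw [e, det_mul, det_mul, det_transpose, hdet]
  have h1 : (1:ℝ) ≤ (P'.det : ℝ) * (P'.det:ℝ) := by
    have : 0 < P'.det * P'.det := mul_self_pos.2 hd
    exact_mod_cast this
  have := (posSemidef_gram ℝ v).det_nonneg
  nlinarith

/-- Finitely generated, and `ℤ`-independence implies `ℝ`-independence. -/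
def Good (N : Submodule ℤ E) : Prop :=
  N.FG ∧ ∀ (n : ℕ) (v : Fin n → E), (∀ i, v i ∈ N) → LinearIndependent ℤ v → LinearIndependent ℝ v

lemma Good.li {N : Submodule ℤ E} (h : Good N) {ι : Type*} [Fintype ι] (v : ι → E)
    (hv : ∀ i, v i ∈ N) (hl : LinearIndependent ℤ v) : LinearIndependent ℝ v := by
  let e := Fintype.equivFin ι
  have := h.2 _ (v ∘ e.symm) (fun i => hv _) (hl.comp _ e.symm.injective)
  have h2 := this.comp _ e.injective
  simpa [Function.comp_assoc] using h2

lemma good_of_isLat [FiniteDimensional ℝ E] (L : Submodule ℤ E) (hL : IsLat L) : Good L := by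
  obtain ⟨hd, -⟩ := hL
  refine ⟨Module.Finite.iff_fg.1 inferInstance, fun n v hv hl => ?_⟩
  have hle : Submodule.span ℤ (Set.range v) ≤ L := by
    rw [Submodule.span_le]; rintro _ ⟨i, rfl⟩; exact hv i
  have hd' : DiscreteTopology (Submodule.span ℤ (Set.range v)) :=
    DiscreteTopology.of_subset hd hle
  have := Real.finrank_eq_int_finrank_of_discrete hd'
  rw [linearIndependent_iff_card_eq_finrank_span, this, Set.finrank, finrank_span_eq_card hl]

lemma exists_basis (N : Submodule ℤ E) (h : N.FG) :
    ∃ (n : ℕ) (v : Fin n → E), LinearIndependent ℤ v ∧ Submodule.span ℤ (Set.range v) = N := by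
  have : Module.Finite ℤ N := Module.Finite.iff_fg.2 h
  have : IsAddTorsionFree E := IsAddTorsionFree.of_isTorsionFree ℝ E
  have : Module.Free ℤ N := inferInstance
  let b := Module.finBasis ℤ N
  refine ⟨_, fun i => (b i : E), ?_, ?_⟩
  · exact b.linearIndependent.map' N.subtype N.ker_subtype
  · have := congrArg (Submodule.map N.subtype) b.span_eq
    rw [Submodule.map_span, ← Set.range_comp, Submodule.map_top, Submodule.range_subtype] at this
    exact this

lemma covol_eq {ι : Type*} [Fintype ι] [DecidableEq ι] (N : Submodule ℤ E) (v : ι → E)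
    (hl : LinearIndependent ℤ v) (hs : Submodule.span ℤ (Set.range v) = N) :
    covol N = Real.sqrt (gram ℝ v).det := by
  subst hs
  let b := Basis.span hl
  have hex : ∃ n : ℕ, Nonempty (Basis (Fin n) ℤ (Submodule.span ℤ (Set.range v))) :=
    ⟨_, ⟨b.reindex (Fintype.equivFin ι)⟩⟩
  rw [covol, dif_pos hex]
  set c := hex.choose_spec.some
  let e := b.indexEquiv c
  let w : ι → E := fun i => (c (e i) : E)
  have hwl : LinearIndependent ℤ w :=
    (c.linearIndependent.map' (Submodule.subtype _) (Submodule.ker_subtype _)).comp _ e.injective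
  have hws : Submodule.span ℤ (Set.range w) = Submodule.span ℤ (Set.range v) := by
    have := congrArg (Submodule.map (Submodule.span ℤ (Set.range v)).subtype) c.span_eq
    rw [Submodule.map_span, ← Set.range_comp] at this
    rw [Submodule.map_top, Submodule.range_subtype] at this
    rw [← this]
    congr 1
    have := e.surjective.range_comp (fun i => (c i : E))
    exact this
  have h1 : (gram ℝ w).det = (gram ℝ v).det := by
    apply le_antisymm
    · exact gram_le _ _ (fun i => hws ▸ Submodule.subset_span ⟨i, rfl⟩) hl
    · exact gram_le _ _ (fun i => hws ▸ Submodule.subset_span ⟨i, rfl⟩) hwl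
  rw [← h1, ← Matrix.det_submatrix_equiv_self e]
  rfl

lemma covol_latIn {ι : Type*} [Fintype ι] [DecidableEq ι] (N : Submodule ℤ E) (G : Submodule ℝ E)
    (v : ι → E) (hl : LinearIndependent ℤ v)
    (hs : Submodule.span ℤ (Set.range v) = N ⊓ G.restrictScalars ℤ) :
    covol (latIn N G) = Real.sqrt (gram ℝ v).det := by
  have hm : ∀ i, v i ∈ N ⊓ G.restrictScalars ℤ := fun i => hs ▸ Submodule.subset_span ⟨i, rfl⟩
  let w : ι → G := fun i => ⟨v i, (hm i).2⟩
  have hw : (G.subtype.restrictScalars ℤ) ∘ w = v := rfl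
  have hl' : LinearIndependent ℤ w := LinearIndependent.of_comp (G.subtype.restrictScalars ℤ) hl
  have hs' : Submodule.span ℤ (Set.range w) = latIn N G := by
    have hinj : Function.Injective (G.subtype.restrictScalars ℤ) := Subtype.val_injective
    apply Submodule.map_injective_of_injective hinj
    rw [Submodule.map_span, ← Set.range_comp, hw, hs, latIn, Submodule.map_comap_eq, inf_comm]
    congr 1
    ext x
    simp
  rw [covol_eq _ w hl' hs']
  rfl

lemma lat_data [FiniteDimensional ℝ E] (N : Submodule ℤ E) (hN : Good N) (G : Submodule ℝ E)
    (hG : IsRational N G) :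
    ∃ (n : ℕ) (v : Fin n → E), LinearIndependent ℤ v ∧ LinearIndependent ℝ v ∧
      Submodule.span ℤ (Set.range v) = N ⊓ G.restrictScalars ℤ ∧
      Submodule.span ℝ (Set.range v) = G ∧ finrank ℝ G = n ∧
      covol (latIn N G) = Real.sqrt (gram ℝ v).det := by
  have hfg : (N ⊓ G.restrictScalars ℤ).FG := hN.1.of_le inf_le_left
  obtain ⟨n, v, hl, hs⟩ := exists_basis _ hfg
  have hm : ∀ i, v i ∈ N ⊓ G.restrictScalars ℤ := fun i => hs ▸ Submodule.subset_span ⟨i, rfl⟩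
  have hr := hN.li v (fun i => (hm i).1) hl
  have hs' : Submodule.span ℝ (Set.range v) = G := by
    have : Submodule.span ℝ ((N ⊓ G.restrictScalars ℤ : Submodule ℤ E) : Set E) = G := hG
    rw [← hs, Submodule.span_span_of_tower] at this
    exact this
  refine ⟨n, v, hl, hr, hs, hs', ?_, covol_latIn N G v hl hs⟩
  rw [← hs', finrank_span_eq_card hr, Fintype.card_fin]

lemma li_sum {E' : Type*} [AddCommGroup E'] (f : E →ₗ[ℤ] E') {a b : Type*} [Fintype a] [Fintype b]
    (u : a → E) (v : b → E) (hu : LinearIndependent ℤ u) (hf : ∀ i, f (u i) = 0)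
    (hv : LinearIndependent ℤ (f ∘ v)) : LinearIndependent ℤ (Sum.elim u v) := by
  rw [Fintype.linearIndependent_iff]
  intro g hg
  simp only [Fintype.sum_sum_type, Sum.elim_inl, Sum.elim_inr] at hg
  have h1 : ∀ j, g (Sum.inr j) = 0 := by
    apply Fintype.linearIndependent_iff.1 hv
    have := congrArg f hg
    simpa [hf] using this
  have h2 : ∀ i, g (Sum.inl i) = 0 := by
    apply Fintype.linearIndependent_iff.1 hu
    simpa [h1] using hg
  rintro (i | j)
  · exact h2 i
  · exact h1 j

/-- The orthogonal projection onto the orthogonal complement, over the integers. -/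
def pr [FiniteDimensional ℝ E] (F : Submodule ℝ E) : E →ₗ[ℝ] Fᗮ :=
  (Submodule.orthogonalProjectionOnto Fᗮ : E →ₗ[ℝ] Fᗮ)

lemma ker_pr [FiniteDimensional ℝ E] (F : Submodule ℝ E) : LinearMap.ker (pr F) = F := by
  ext x
  rw [LinearMap.mem_ker]
  change Submodule.orthogonalProjectionOnto Fᗮ x = 0 ↔ _
  rw [Submodule.orthogonalProjectionOnto_eq_zero_iff, Submodule.orthogonal_orthogonal]

lemma good_quot [FiniteDimensional ℝ E] (L : Submodule ℤ E) (hL : Good L) (F : Submodule ℝ E)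
    (hF : IsRational L F) : Good (quotLat L F) := by
  refine ⟨hL.1.map _, fun n r hr hl => ?_⟩
  have : ∀ i, ∃ x ∈ L, pr F x = r i := fun i => hr i
  choose v hvL hv using this
  obtain ⟨k, w, hwl, -, hws, hwF, -, -⟩ := lat_data L hL F hF
  have hm : ∀ i, w i ∈ L ⊓ F.restrictScalars ℤ := fun i => hws ▸ Submodule.subset_span ⟨i, rfl⟩
  have e : r = pr F ∘ v := by ext1 i; exact (hv i).symm
  have h1 : LinearIndependent ℤ (Sum.elim w v) := by
    refine li_sum ((pr F).restrictScalars ℤ) w v hwl (fun i => ?_) ?_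
    · have : w i ∈ LinearMap.ker (pr F) := by rw [ker_pr]; exact (hm i).2
      exact this
    · rw [e] at hl; exact hl
  have h2 : LinearIndependent ℝ (Sum.elim w v) := hL.li _ (by
    rintro (i | i)
    · exact (hm i).1
    · exact hvL i) h1
  rw [linearIndependent_sum] at h2
  rw [e]
  refine LinearIndependent.map h2.2.1 ?_
  rw [ker_pr, ← hwF]
  exact h2.2.2.symm

lemma covol_nonneg (N : Submodule ℤ E) : 0 ≤ covol N := by
  unfold covol
  split_ifs
  · exact Real.sqrt_nonneg _
  · exact le_rfl

lemma Hr_nonneg (N : Submodule ℤ E) (G : Submodule ℝ E) : 0 ≤ Hr N G :=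
  Real.rpow_nonneg (covol_nonneg _) _

lemma Hmin_nonneg (N : Submodule ℤ E) : 0 ≤ Hmin N := by
  apply Real.sInf_nonneg
  rintro _ ⟨G, -, -, rfl⟩
  exact Hr_nonneg _ _

lemma Hmin_le (N : Submodule ℤ E) (G : Submodule ℝ E) (h0 : G ≠ ⊥) (hG : IsRational N G) :
    Hmin N ≤ Hr N G := by
  apply csInf_le
  · refine ⟨0, ?_⟩
    rintro _ ⟨G, -, -, rfl⟩
    exact Hr_nonneg _ _
  · exact ⟨G, h0, hG, rfl⟩

lemma pow_le_covol [FiniteDimensional ℝ E] (N : Submodule ℤ E) (hN : Good N) (m : ℝ) (hm0 : 0 ≤ m)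
    (hm : m ≤ Hmin N) (G : Submodule ℝ E) (hG : IsRational N G) :
    m ^ finrank ℝ G ≤ covol (latIn N G) := by
  obtain ⟨n, v, hl, -, -, hsp, hn, hc⟩ := lat_data N hN G hG
  by_cases h0 : G = ⊥
  · have : n = 0 := by rw [← hn, h0]; simp
    subst this
    rw [hc, hn]; simp
  · have h1 := hm.trans (Hmin_le N G h0 hG)
    have hpos : finrank ℝ G ≠ 0 := by
      rw [Ne, Submodule.finrank_eq_zero]; exact h0
    calc m ^ finrank ℝ G ≤ (Hr N G) ^ finrank ℝ G := pow_le_pow_left₀ hm0 h1 _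
      _ = covol (latIn N G) := by
        rw [Hr, redH]
        exact Real.rpow_inv_natCast_pow (covol_nonneg _) hpos

lemma le_Hr [FiniteDimensional ℝ E] (N : Submodule ℤ E) (m : ℝ) (hm0 : 0 ≤ m) (G : Submodule ℝ E)
    (h0 : G ≠ ⊥) (h : m ^ finrank ℝ G ≤ covol (latIn N G)) : m ≤ Hr N G := by
  have hpos : finrank ℝ G ≠ 0 := by
    rw [Ne, Submodule.finrank_eq_zero]; exact h0
  rw [← Real.pow_rpow_inv_natCast hm0 hpos]
  exact Real.rpow_le_rpow (by positivity) h (by positivity)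

lemma rational_map (L : Submodule ℤ E) (F : Submodule ℝ E) (G : Submodule ℝ F) :
    IsRational L (G.map F.subtype) ↔ IsRational (latIn L F) G := by
  have : ((L : Set E) ∩ (G.map F.subtype : Submodule ℝ E)) =
      F.subtype '' ((latIn L F : Set F) ∩ (G : Set F)) := by
    ext x
    constructor
    · rintro ⟨hx, y, hy, rfl⟩
      exact ⟨y, ⟨hx, hy⟩, rfl⟩
    · rintro ⟨y, ⟨hy, hG⟩, rfl⟩
      exact ⟨hy, y, hG, rfl⟩
  rw [IsRational, IsRational, this, ← Submodule.map_span]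
  exact (Submodule.map_injective_of_injective F.injective_subtype).eq_iff

lemma good_latIn [FiniteDimensional ℝ E] (L : Submodule ℤ E) (hL : Good L) (F : Submodule ℝ E)
    : Good (latIn L F) := by
  have hinj : Function.Injective (F.subtype.restrictScalars ℤ) := Subtype.val_injective
  constructor
  · apply Submodule.fg_of_fg_map_injective _ hinj
    refine hL.1.of_le ?_
    exact Submodule.map_comap_le _ _
  · intro n v hv hl
    have h1 : LinearIndependent ℤ ((F.subtype.restrictScalars ℤ) ∘ v) :=
      hl.map' _ (LinearMap.ker_eq_bot.2 hinj)
    have h2 := hL.2 n _ (fun i => hv i) h1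
    exact LinearIndependent.of_comp F.subtype h2

lemma covol_map [FiniteDimensional ℝ E] (L : Submodule ℤ E) (hL : Good L) (F : Submodule ℝ E)
    (G : Submodule ℝ F) (hG : IsRational (latIn L F) G) :
    covol (latIn L (G.map F.subtype)) = covol (latIn (latIn L F) G) := by
  obtain ⟨n, v, hl, -, hs, -, -, hc⟩ := lat_data _ (good_latIn L hL F) G hG
  have hinj : Function.Injective (F.subtype.restrictScalars ℤ) := Subtype.val_injective
  rw [hc, covol_latIn L (G.map F.subtype) ((F.subtype.restrictScalars ℤ) ∘ v)
    (hl.map' _ (LinearMap.ker_eq_bot.2 hinj))]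
  · rfl
  · rw [Set.range_comp, ← Submodule.map_span, hs]
    ext x
    constructor
    · rintro ⟨y, ⟨hy, hG⟩, rfl⟩
      exact ⟨hy, y, hG, rfl⟩
    · rintro ⟨hx, y, hy, rfl⟩
      exact ⟨y, ⟨hx, hy⟩, rfl⟩

lemma Hr_map [FiniteDimensional ℝ E] (L : Submodule ℤ E) (hL : Good L) (F : Submodule ℝ E)
    (G : Submodule ℝ F) (hG : IsRational (latIn L F) G) :
    Hr L (G.map F.subtype) = Hr (latIn L F) G := by
  rw [Hr, Hr, redH, redH, covol_map L hL F G hG, Submodule.finrank_map_subtype_eq]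

lemma main_ineq [FiniteDimensional ℝ E] (L : Submodule ℤ E) (hL : Good L) (F : Submodule ℝ E)
    (hF : IsRational L F) (m : ℝ) (hm0 : 0 ≤ m) (hm1 : m ≤ Hmin (latIn L F))
    (hm2 : m ≤ Hmin (quotLat L F)) (G : Submodule ℝ E) (hG : IsRational L G) :
    m ^ finrank ℝ G ≤ covol (latIn L G) := by
  set H : Submodule ℤ E := L ⊓ G.restrictScalars ℤ with hH
  have hfg : H.FG := hL.1.of_le inf_le_left
  let f : E →ₗ[ℤ] Fᗮ := (pr F).restrictScalars ℤ
  have hkf : ∀ x, f x = 0 ↔ x ∈ F := by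
    intro x
    change x ∈ LinearMap.ker (pr F) ↔ _
    rw [ker_pr]
  obtain ⟨a, u, hul, hus⟩ := exists_basis (H ⊓ F.restrictScalars ℤ) (hfg.of_le inf_le_left)
  obtain ⟨b, r, hrl, hrs⟩ := exists_basis (H.map f) (hfg.map f)
  have hu : ∀ i, u i ∈ H ⊓ F.restrictScalars ℤ := fun i => hus ▸ Submodule.subset_span ⟨i, rfl⟩
  have hr : ∀ i, r i ∈ H.map f := fun i => hrs ▸ Submodule.subset_span ⟨i, rfl⟩
  choose v hvH hv using hr
  have e : r = f ∘ v := by ext1 i; exact (hv i).symm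
  have hl : LinearIndependent ℤ (Sum.elim u v) :=
    li_sum f u v hul (fun i => (hkf _).2 (hu i).2) (e ▸ hrl)
  have hmem : ∀ i, Sum.elim u v i ∈ H := by
    rintro (i | i)
    · exact (hu i).1
    · exact hvH i
  have hs : Submodule.span ℤ (Set.range (Sum.elim u v)) = H := by
    apply le_antisymm
    · rw [Submodule.span_le]; rintro _ ⟨i, rfl⟩; exact hmem i
    · intro x hx
      have h1 : f x ∈ Submodule.span ℤ (Set.range r) := hrs ▸ ⟨x, hx, rfl⟩
      rw [e, Set.range_comp, ← Submodule.map_span] at h1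
      obtain ⟨y, hy, hyx⟩ := h1
      have hyH : y ∈ H := by
        have : Submodule.span ℤ (Set.range v) ≤ H := by
          rw [Submodule.span_le]; rintro _ ⟨i, rfl⟩; exact hvH i
        exact this hy
      have h2 : x - y ∈ Submodule.span ℤ (Set.range u) := by
        rw [hus]
        refine ⟨H.sub_mem hx hyH, ?_⟩
        refine (hkf _).1 ?_
        rw [map_sub, hyx, sub_self]
      rw [Set.Sum.elim_range, Submodule.span_union]
      have := Submodule.add_mem_sup h2 hy
      simpa using this
  have hlR : LinearIndependent ℝ (Sum.elim u v) := hL.li _ (fun i => (hmem i).1) hl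
  have hrq : ∀ i, r i ∈ quotLat L F := fun i => ⟨v i, (hvH i).1, hv i⟩
  have hrR : LinearIndependent ℝ r := (good_quot L hL F hF).li r hrq hrl
  have hsR : Submodule.span ℝ (Set.range (Sum.elim u v)) = G := by
    have : Submodule.span ℝ (H : Set E) = G := hG
    rw [← hs, Submodule.span_span_of_tower] at this
    exact this
  have hdim : finrank ℝ G = a + b := by
    rw [← hsR, finrank_span_eq_card hlR]; simp
  have huR : LinearIndependent ℝ u := (linearIndependent_sum.1 hlR).1
  -- the intersection
  set A : Submodule ℝ E := Submodule.span ℝ (Set.range u) with hA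
  have hAF : A ≤ F := by
    rw [hA, Submodule.span_le]; rintro _ ⟨i, rfl⟩; exact (hu i).2
  have hAG : A ≤ G := by
    rw [hA, Submodule.span_le]; rintro _ ⟨i, rfl⟩; exact (hu i).1.2
  have hAdim : finrank ℝ A = a := by rw [hA, finrank_span_eq_card huR, Fintype.card_fin]
  have hGFA : G ⊓ F ≤ A := by
    rintro x ⟨hxG, hxF⟩
    rw [SetLike.mem_coe, ← hsR, Set.Sum.elim_range, Submodule.span_union, Submodule.mem_sup] at hxG
    obtain ⟨y, hy, z, hz, rfl⟩ := hxG
    have hzF : z ∈ F := (Submodule.add_mem_iff_right F (hAF hy)).1 hxF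
    have hz0 : z = 0 := by
      obtain ⟨c, rfl⟩ := (Submodule.mem_span_range_iff_exists_fun ℝ).1 hz
      have h1 : pr F (∑ i, c i • v i) = 0 := (hkf _).2 hzF
      rw [map_sum] at h1
      have h2 : ∑ i, c i • r i = 0 := by
        rw [← h1]
        refine Finset.sum_congr rfl fun i _ => ?_
        rw [map_smul, ← hv i]; rfl
      have h3 := Fintype.linearIndependent_iff.1 hrR c h2
      simp [h3]
    rw [hz0, add_zero]; exact hy
  have hAint : L ⊓ A.restrictScalars ℤ = H ⊓ F.restrictScalars ℤ := by
    apply le_antisymm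
    · rintro x ⟨hx, hxA⟩
      exact ⟨⟨hx, hAG hxA⟩, hAF hxA⟩
    · rintro x ⟨⟨hx, hxG⟩, hxF⟩
      exact ⟨hx, hGFA ⟨hxG, hxF⟩⟩
  have hArat : IsRational L A := by
    have : Submodule.span ℝ ((L ⊓ A.restrictScalars ℤ : Submodule ℤ E) : Set E) = A := by
      rw [hAint, ← hus, Submodule.span_span_of_tower]
    exact this
  have hAcov : covol (latIn L A) = Real.sqrt (gram ℝ u).det :=
    covol_latIn L A u hul (hus.trans hAint.symm)
  have hA1 : m ^ a ≤ Real.sqrt (gram ℝ u).det := by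
    let A' : Submodule ℝ F := A.comap F.subtype
    have hA' : A'.map F.subtype = A := by
      rw [Submodule.map_comap_eq, Submodule.range_subtype, inf_eq_right]; exact hAF
    have hr' : IsRational (latIn L F) A' := by
      rw [← rational_map, hA']; exact hArat
    have h1 := pow_le_covol _ (good_latIn L hL F) m hm0 hm1 A' hr'
    rw [← covol_map L hL F A' hr', ← Submodule.finrank_map_subtype_eq, hA', hAdim, hAcov] at h1
    exact h1
  -- the image
  set B : Submodule ℝ Fᗮ := Submodule.span ℝ (Set.range r) with hB
  have hRB : Submodule.span ℤ (Set.range r) ≤ quotLat L F ⊓ B.restrictScalars ℤ := by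
    rw [Submodule.span_le]
    rintro _ ⟨i, rfl⟩
    exact ⟨hrq i, Submodule.subset_span ⟨i, rfl⟩⟩
  have hBrat : IsRational (quotLat L F) B := by
    apply le_antisymm
    · rw [Submodule.span_le]; exact Set.inter_subset_right
    · rw [hB, Submodule.span_le]
      rintro _ ⟨i, rfl⟩
      exact Submodule.subset_span (hRB (Submodule.subset_span ⟨i, rfl⟩))
  have hBdim : finrank ℝ B = b := by rw [hB, finrank_span_eq_card hrR, Fintype.card_fin]
  obtain ⟨n, t, htl, -, hts, -, htn, htc⟩ := lat_data _ (good_quot L hL F hF) B hBrat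
  have hB1 := pow_le_covol _ (good_quot L hL F hF) m hm0 hm2 B hBrat
  obtain rfl : n = b := htn.symm.trans hBdim
  have hB2 : (gram ℝ t).det ≤ (gram ℝ r).det := by
    refine gram_le t r (fun i => ?_) hrl
    rw [hts]
    exact hRB (Submodule.subset_span ⟨i, rfl⟩)
  rw [hBdim, htc] at hB1
  have hB3 : m ^ n ≤ Real.sqrt (gram ℝ r).det := hB1.trans (Real.sqrt_le_sqrt hB2)
  -- assembling
  have hblock := gram_block u v (fun j => v j - (r j : E)) (fun j => (r j : E)) (by simp)
    (fun i j => (r j).2 _ (hu i).2)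
    (fun i j => (r j).2 _ (by
      refine (hkf _).1 ?_
      rw [map_sub, hv i, sub_eq_zero]
      change r i = Submodule.orthogonalProjectionOnto Fᗮ (r i : E)
      rw [Submodule.orthogonalProjectionOnto_mem_subspace_eq_self]))
    huR (hrR.map' Fᗮ.subtype (Submodule.ker_subtype _))
  have hg : gram ℝ (fun j => (r j : E)) = gram ℝ r := rfl
  rw [hg] at hblock
  rw [covol_latIn L G _ hl hs, hdim, pow_add]
  calc m ^ a * m ^ n ≤ Real.sqrt (gram ℝ u).det * Real.sqrt (gram ℝ r).det :=
        mul_le_mul hA1 hB3 (by positivity) (Real.sqrt_nonneg _)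
    _ = Real.sqrt ((gram ℝ u).det * (gram ℝ r).det) :=
        (Real.sqrt_mul (posSemidef_gram ℝ u).det_nonneg _).symm
    _ ≤ _ := Real.sqrt_le_sqrt hblock

end Helpers

/-- For a Euclidean lattice `(E, L)` and a nonzero rational subspace `F`,
`min(H_min(F, F ∩ L), H_min(quotient)) ≤ H_min(E, L) ≤ H_min(F, F ∩ L)`; in particular if
`H_min(F, F ∩ L) ≤ H_min(quotient)` then `H_min(E, L) = H_min(F, F ∩ L)`. -/
theorem statement0 {E : Type*} [NormedAddCommGroup E] [InnerProductSpace ℝ E]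
    [FiniteDimensional ℝ E] (L : Submodule ℤ E) (hL : IsLat L)
    (F : Submodule ℝ E) (hF : F ≠ ⊥) (hFrat : IsRational L F) :
    (min (Hmin (latIn L F)) (Hmin (quotLat L F)) ≤ Hmin L ∧ Hmin L ≤ Hmin (latIn L F)) ∧
    (Hmin (latIn L F) ≤ Hmin (quotLat L F) → Hmin L = Hmin (latIn L F)) := by
  have hg := good_of_isLat L hL
  have hFtop : IsRational (latIn L F) ⊤ := by
    rw [← rational_map, Submodule.map_top, Submodule.range_subtype]
    exact hFrat
  have h2 : Hmin L ≤ Hmin (latIn L F) := by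
    apply le_csInf
    · refine ⟨_, ⊤, ?_, hFtop, rfl⟩
      intro h
      apply hF
      have := congrArg (Submodule.map F.subtype) h
      simpa using this
    · rintro _ ⟨G, hG0, hG, rfl⟩
      rw [← Hr_map L hg F G hG]
      refine Hmin_le L _ ?_ ((rational_map L F G).2 hG)
      intro h0
      apply hG0
      apply Submodule.map_injective_of_injective F.injective_subtype
      rw [h0, Submodule.map_bot]
  have h1 : min (Hmin (latIn L F)) (Hmin (quotLat L F)) ≤ Hmin L := by
    have hm0 : 0 ≤ min (Hmin (latIn L F)) (Hmin (quotLat L F)) :=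
      le_min (Hmin_nonneg _) (Hmin_nonneg _)
    apply le_csInf
    · refine ⟨_, F, hF, hFrat, rfl⟩
    · rintro _ ⟨G, hG0, hG, rfl⟩
      exact le_Hr L _ hm0 G hG0
        (main_ineq L hg F hFrat _ hm0 (min_le_left _ _) (min_le_right _ _) G hG)
  refine ⟨⟨h1, h2⟩, fun h => le_antisymm h2 ?_⟩
  rwa [min_eq_left h] at h1

end EucLat
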